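/- arXiv:2505.07025 — 3 statements merged into one kernel-verified Lean document; each statement's English description precedes it below -/
import Mathlib

section
/- For all integers t ≥ 4, r ≥ 3 and 0 ≤ d ≤ r-1, there exist a constant c = c(t,r) > 0 and an n_0 such that for all n ≥ n_0, C_r(n, S_r(d,t)) ≥ min{ c · n^{1/(2(r-d)+1)}, c · n^{1/(d+1)} }. -/
open Finset

/-- A hypergraph on a finite set of natural-number vertices. -/
structure HGraph where
  verts : Finset ℕ
  edges : Finset (Finset ℕ)

/-- `H` is an `r`-uniform hypergraph. -/
def HGraph.IsUniform (H : HGraph) (r : ℕ) : Prop :=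
  ∀ e ∈ H.edges, e ⊆ H.verts ∧ e.card = r

/-- `φ` determines a copy of `H` in the complete hypergraph on vertex set `range n`. -/
def IsCopy (n : ℕ) (H : HGraph) (φ : ℕ → ℕ) : Prop :=
  Set.InjOn φ ↑H.verts ∧ ∀ v ∈ H.verts, φ v ∈ Finset.range n

/-- The family of edge-colourings `f v` with `k` colours is an `(n,r,H)`-local colouring:
for every copy of `H` there is a vertex of the copy whose colouring is rainbow on it. -/
def IsLocalColoring (n k : ℕ) (H : HGraph) (f : ℕ → Finset ℕ → Fin k) : Prop :=
  ∀ φ : ℕ → ℕ, IsCopy n H φ →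
    ∃ x ∈ H.verts, ∀ e₁ ∈ H.edges, ∀ e₂ ∈ H.edges,
      f (φ x) (e₁.image φ) = f (φ x) (e₂.image φ) → e₁ = e₂

/-- The local rainbow colouring number `C_r(n,H)`:
the least number of colours admitting an `(n,r,H)`-local colouring. -/
noncomputable def localC (n : ℕ) (H : HGraph) : ℕ :=
  sInf {k | ∃ f : ℕ → Finset ℕ → Fin k, IsLocalColoring n k H f}

/-- The sunflower `S_r(d,m)`: `m` edges of size `r` with common core `{1,…,d}`
and pairwise disjoint petals. -/
def sunflowerH (r d m : ℕ) : HGraph :=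
  ⟨Finset.Icc 1 (d + m * (r - d)),
   (Finset.Icc 1 m).image fun i =>
     Finset.Icc 1 d ∪ Finset.Icc (d + (i - 1) * (r - d) + 1) (d + i * (r - d))⟩

/-- Every hypergraph with a vertex, all of whose edges lie in its vertex set, has a local
colouring with finitely many colours. -/
lemma exists_isLocalColoring (n : ℕ) (H : HGraph) (hv : H.verts.Nonempty)
    (he : ∀ e ∈ H.edges, e ⊆ H.verts) :
    ∃ k, ∃ f : ℕ → Finset ℕ → Fin k, IsLocalColoring n k H f := by
  classical
  let E := (range n).powerset.equivFin
  refine ⟨#(range n).powerset, fun _ e => if h : e ⊆ range n then E ⟨e, mem_powerset.2 h⟩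
    else E ⟨∅, empty_mem_powerset _⟩, ?_⟩
  rintro φ ⟨hinj, hmem⟩
  obtain ⟨x, hx⟩ := hv
  refine ⟨x, hx, fun e₁ h₁ e₂ h₂ h => ?_⟩
  have sub : ∀ e ∈ H.edges, e.image φ ⊆ range n := fun e h y hy => by
    obtain ⟨z, hz, rfl⟩ := mem_image.1 hy
    exact hmem z (he e h hz)
  simp only [dif_pos (sub e₁ h₁), dif_pos (sub e₂ h₂)] at h
  have h := congrArg Subtype.val (E.injective h)
  simp only at h
  have aux : ∀ e ∈ H.edges, ∀ e' ∈ H.edges, e.image φ = e'.image φ → e ⊆ e' := by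
    intro e h e' h' hh y hy
    have : φ y ∈ e'.image φ := hh ▸ mem_image_of_mem φ hy
    obtain ⟨z, hz, hzy⟩ := mem_image.1 this
    rwa [← hinj (he e' h' hz) (he e h hy) hzy]
  exact (aux _ h₁ _ h₂ h).antisymm (aux _ h₂ _ h₁ h.symm)

/-- A `k`-colouring of `I` has at least `#I - k` monochromatic ordered pairs. -/
lemma card_le_card_monochromatic_add {k : ℕ} (I : Finset ℕ) (g : ℕ → Fin k) :
    #I ≤ #{p ∈ I.offDiag | g p.1 = g p.2} + k := by
  classical
  have h : ∀ c, ∃ i, c ∈ I.image g → i ∈ I ∧ g i = c := fun c => by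
    by_cases hc : c ∈ I.image g
    · obtain ⟨i, hi, h⟩ := mem_image.1 hc
      exact ⟨i, fun _ => ⟨hi, h⟩⟩
    · exact ⟨0, fun h => absurd h hc⟩
  choose rep hrep using h
  have h1 : #(univ.image rep) ≤ k := card_image_le.trans (by simp)
  have h2 : #(I \ univ.image rep) ≤ #{p ∈ I.offDiag | g p.1 = g p.2} := by
    refine card_le_card_of_injOn (fun i => (i, rep (g i))) ?_ ?_
    · intro i hi
      obtain ⟨hi, hn⟩ := mem_sdiff.1 hi
      obtain ⟨ha, hb⟩ := hrep (g i) (mem_image_of_mem g hi)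
      simp only [coe_filter, Set.mem_ofPred_eq, mem_offDiag]
      exact ⟨⟨hi, ha, fun h => hn (h ▸ mem_image_of_mem rep (mem_univ _))⟩, hb.symm⟩
    · intro i _ j _ h
      exact (Prod.mk.inj h).1
  have h3 := le_card_sdiff (univ.image rep) I
  omega

/-- If `2 * k` objects are `k`-coloured by each of `n` voters, some two distinct objects receive
equal colours from at least `n / (4 * k)` voters. -/
lemma exists_popular_pair {k n : ℕ} (hk : 0 < k) (I : Finset ℕ) (hI : #I = 2 * k)
    (g : ℕ → ℕ → Fin k) :
    ∃ i ∈ I, ∃ j ∈ I, i ≠ j ∧ n ≤ 4 * k * #{v ∈ range n | g v i = g v j} := by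
  classical
  by_contra! hcon
  have h1 : ∑ v ∈ range n, #{p ∈ I.offDiag | g v p.1 = g v p.2}
      = ∑ p ∈ I.offDiag, #{v ∈ range n | g v p.1 = g v p.2} := by
    simp only [card_filter]
    exact sum_comm
  have h2 : n * k ≤ ∑ v ∈ range n, #{p ∈ I.offDiag | g v p.1 = g v p.2} := by
    have := card_nsmul_le_sum (range n) (fun v => #{p ∈ I.offDiag | g v p.1 = g v p.2}) k
      (fun v _ => by have := card_le_card_monochromatic_add I (g v); omega)
    simpa using this
  have hne : I.offDiag.Nonempty := by
    rw [← card_pos, offDiag_card, hI]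
    have : 2 * k * 1 < 2 * k * (2 * k) := by
      apply Nat.mul_lt_mul_of_pos_left <;> omega
    omega
  have h3 : ∑ p ∈ I.offDiag, 4 * k * #{v ∈ range n | g v p.1 = g v p.2}
      < ∑ p ∈ I.offDiag, n := by
    refine sum_lt_sum_of_nonempty hne fun p hp => ?_
    obtain ⟨ha, hb, hab⟩ := mem_offDiag.1 hp
    exact hcon _ ha _ hb hab
  rw [← mul_sum, ← h1, sum_const, offDiag_card, hI, smul_eq_mul] at h3
  have h4 : (2 * k * (2 * k) - 2 * k) * n ≤ 2 * k * (2 * k) * n :=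
    Nat.mul_le_mul_right _ (Nat.sub_le _ _)
  nlinarith [Nat.mul_le_mul_left (4 * k) h2]

/-- The edge with core `{0, …, d - 1}` and petal `p '' {0, …, s - 1}`. -/
def petalEdge (d s : ℕ) (p : ℕ → ℕ) : Finset ℕ := range d ∪ (range s).image p

/-- A family of disjoint petals avoiding the core `{0, …, d - 1}` yields a copy of the sunflower. -/
lemma IsLocalColoring.exists_rainbow_of_petals {n k d s t : ℕ} {f : ℕ → Finset ℕ → Fin k}
    (hf : IsLocalColoring n k (sunflowerH (d + s) d t) f) (hs : 0 < s) (hdn : d ≤ n)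
    (P : ℕ → ℕ → ℕ) (hP : ∀ i < t, ∀ a < s, d ≤ P i a ∧ P i a < n)
    (hinj : ∀ i < t, ∀ a < s, ∀ j < t, ∀ b < s, P i a = P j b → i = j ∧ a = b) :
    ∃ x, (x < d ∨ ∃ l < t, ∃ a < s, x = P l a) ∧ ∀ i < t, ∀ j < t,
      f x (petalEdge d s (P i)) = f x (petalEdge d s (P j)) → i = j := by
  let φ : ℕ → ℕ := fun x => if x ≤ d then x - 1 else P ((x - d - 1) / s) ((x - d - 1) % s)
  have hcore : ∀ x, x ≤ d → φ x = x - 1 := fun x h => if_pos h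
  have hout : ∀ l < t, ∀ a < s, φ (d + l * s + a + 1) = P l a := by
    intro l _ a ha
    have h1 : d + l * s + a + 1 - d - 1 = a + l * s := by omega
    simp only [φ]
    rw [if_neg (by omega), h1, Nat.add_mul_div_right _ _ hs, Nat.add_mul_mod_self_right,
      Nat.div_eq_of_lt ha, Nat.mod_eq_of_lt ha, zero_add]
  have hform : ∀ x ∈ Icc 1 (d + t * s), (1 ≤ x ∧ x ≤ d) ∨
      ∃ l < t, ∃ a < s, x = d + l * s + a + 1 := by
    intro x hx
    rw [mem_Icc] at hx
    by_cases h : x ≤ d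
    · exact Or.inl ⟨hx.1, h⟩
    · refine Or.inr ⟨(x - d - 1) / s, (Nat.div_lt_iff_lt_mul hs).2 (by omega),
        (x - d - 1) % s, Nat.mod_lt _ hs, ?_⟩
      have := Nat.div_add_mod' (x - d - 1) s
      omega
  have hcopy : IsCopy n (sunflowerH (d + s) d t) φ := by
    simp only [IsCopy, sunflowerH, Nat.add_sub_cancel_left]
    constructor
    · intro x hx y hy hxy
      rcases hform x hx with h1 | ⟨l, hl, a, ha, rfl⟩ <;>
        rcases hform y hy with h2 | ⟨l', hl', a', ha', rfl⟩
      · rw [hcore x h1.2, hcore y h2.2] at hxy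
        omega
      · rw [hcore x h1.2, hout _ hl' _ ha'] at hxy
        have := hP _ hl' _ ha'
        omega
      · rw [hcore y h2.2, hout _ hl _ ha] at hxy
        have := hP _ hl _ ha
        omega
      · rw [hout _ hl _ ha, hout _ hl' _ ha'] at hxy
        obtain ⟨rfl, rfl⟩ := hinj _ hl _ ha _ hl' _ ha' hxy
        rfl
    · intro x hx
      rw [mem_range]
      rcases hform x hx with h1 | ⟨l, hl, a, ha, rfl⟩
      · rw [hcore x h1.2]
        omega
      · rw [hout _ hl _ ha]
        exact (hP _ hl _ ha).2
  have himage : ∀ i < t, (Icc 1 d ∪ Icc (d + i * s + 1) (d + (i + 1) * s)).image φ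
      = petalEdge d s (P i) := by
    intro i hi
    ext y
    simp only [petalEdge, mem_image, mem_union, mem_Icc, mem_range, add_mul, one_mul]
    constructor
    · rintro ⟨x, h | h, rfl⟩
      · left
        rw [hcore x h.2]
        omega
      · right
        refine ⟨x - d - i * s - 1, by omega, ?_⟩
        rw [← hout i hi _ (by omega)]
        congr 1
        omega
    · rintro (h | ⟨a, ha, rfl⟩)
      · exact ⟨y + 1, Or.inl (by omega), by rw [hcore _ (by omega)]; omega⟩
      · exact ⟨d + i * s + a + 1, Or.inr (by omega), hout i hi a ha⟩
  obtain ⟨x, hx, hrain⟩ := hf φ hcopy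
  simp only [sunflowerH, Nat.add_sub_cancel_left] at hx hrain
  refine ⟨φ x, ?_, fun i hi j hj hij => ?_⟩
  · rcases hform x hx with h1 | ⟨l, hl, a, ha, rfl⟩
    · left
      rw [hcore x h1.2]
      omega
    · exact Or.inr ⟨l, hl, a, ha, hout _ hl _ ha⟩
  · have hmem : ∀ i < t, Icc 1 d ∪ Icc (d + i * s + 1) (d + (i + 1) * s) ∈
        (Icc 1 t).image fun i => Icc 1 d ∪ Icc (d + (i - 1) * s + 1) (d + i * s) :=
      fun i hi => mem_image.2 ⟨i + 1, by rw [mem_Icc]; omega, by simp⟩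
    rw [← himage i hi, ← himage j hj] at hij
    have heq := hrain _ (hmem i hi) _ (hmem j hj) hij
    have key : ∀ i j, Icc 1 d ∪ Icc (d + i * s + 1) (d + (i + 1) * s) =
        Icc 1 d ∪ Icc (d + j * s + 1) (d + (j + 1) * s) → j ≤ i := by
      intro i j h
      have h1 : d + i * s + 1 ∈ Icc 1 d ∪ Icc (d + j * s + 1) (d + (j + 1) * s) := by
        rw [← h]
        simp only [mem_union, mem_Icc, add_mul, one_mul]
        omega
      simp only [mem_union, mem_Icc] at h1
      exact Nat.le_of_mul_le_mul_right (by omega : j * s ≤ i * s) hs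
    exact le_antisymm (key _ _ heq.symm) (key _ _ heq)

/-- Pairs `(i, a)` with `a < s` are determined by `i * s + a`. -/
lemma eq_and_eq_of_mul_add_eq {s i a j b : ℕ} (ha : a < s) (hb : b < s)
    (h : i * s + a = j * s + b) : i = j ∧ a = b := by
  have hs : 0 < s := by omega
  have h1 : i = j := by
    have := congrArg (· / s) h
    simpa [Nat.add_comm _ a, Nat.add_comm _ b, Nat.add_mul_div_right _ _ hs,
      Nat.div_eq_of_lt ha, Nat.div_eq_of_lt hb] using this
  subst h1
  exact ⟨rfl, by omega⟩

/-- With `k` colours there is no local colouring for the sunflower once `n` is large compared with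
`k ^ (d + 1)` and `k ^ (2 * s + 1)`. -/
lemma not_isLocalColoring_sunflowerH {n k d s t : ℕ} (hs : 0 < s) (ht : 4 ≤ t) (hk : 0 < k)
    (h₁ : (4 * s * (t + 2) + 4 * d + 8 * s) * k ^ (2 * s + 1) ≤ n)
    (h₂ : (4 * s * (t + 2) + 4 * d + 8 * s) * k ^ (d + 1) ≤ n)
    (f : ℕ → Finset ℕ → Fin k) :
    ¬ IsLocalColoring n k (sunflowerH (d + s) d t) f := by
  classical
  intro hf
  let Q : ℕ → ℕ → ℕ := fun i a => d + i * s + a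
  have hkd : 1 ≤ k ^ d := Nat.one_le_pow _ _ hk
  have hks : 1 ≤ k ^ (2 * s) := Nat.one_le_pow _ _ hk
  -- Many petals are indistinguishable to the core.
  obtain ⟨c, -, hc⟩ := exists_lt_card_fiber_of_mul_lt_card_of_maps_to
    (s := range (k ^ d * (2 * k) + 1)) (t := (univ : Finset (Fin d → Fin k)))
    (f := fun i x => f x (petalEdge d s (Q i))) (n := 2 * k)
    (fun _ _ => mem_univ _) (by simp)
  obtain ⟨I, hIsub, hI⟩ := exists_subset_card_eq hc.le
  obtain ⟨i₀, hi₀, j₀, hj₀, hne, hpop⟩ := exists_popular_pair (n := n) hk I hI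
    (fun v i => f v (petalEdge d s (Q i)))
  have hIprop : ∀ i ∈ I, i ≤ k ^ d * (2 * k) ∧
      ∀ x (hx : x < d), f x (petalEdge d s (Q i)) = c ⟨x, hx⟩ := by
    intro i hi
    have := mem_filter.1 (hIsub hi)
    exact ⟨by have := mem_range.1 this.1; omega, fun x hx => congrFun this.2 ⟨x, hx⟩⟩
  have hQn : ∀ i ∈ I, ∀ a < s, d ≤ Q i a ∧ Q i a < n := by
    intro i hi a ha
    have h := (hIprop i hi).1
    refine ⟨by simp only [Q]; omega, ?_⟩
    have h3 : i * s ≤ k ^ d * (2 * k) * s := Nat.mul_le_mul_right _ h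
    have h4 : 1 ≤ k ^ (d + 1) := Nat.one_le_pow _ _ hk
    have h5 : k ^ d * (2 * k) * s = 2 * s * k ^ (d + 1) := by ring
    have h6 : (d + 3 * s) * k ^ (d + 1) ≤ n :=
      (Nat.mul_le_mul_right _ (by nlinarith)).trans h₂
    have h7 : (d + s) * 1 ≤ (d + s) * k ^ (d + 1) := Nat.mul_le_mul_left _ h4
    simp only [Q]
    nlinarith
  set M := {v ∈ range n | f v (petalEdge d s (Q i₀)) = f v (petalEdge d s (Q j₀))} with hM
  let B := petalEdge d s (Q i₀) ∪ (range s).image (Q j₀)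
  have hB : #B ≤ d + 2 * s := by
    have ha := card_union_le (petalEdge d s (Q i₀)) ((range s).image (Q j₀))
    have hb := card_union_le (range d) ((range s).image (Q i₀))
    have hc := card_image_le (s := range s) (f := Q i₀)
    have hd := card_image_le (s := range s) (f := Q j₀)
    simp only [card_range] at *
    simp only [B]
    unfold petalEdge at *
    omega
  have hM' : s * (t + k ^ (2 * s) + 1) ≤ #(M \ B) := by
    have ha := le_card_sdiff B M
    have hb : s * (t + k ^ (2 * s) + 1) + (d + 2 * s) ≤ #M := by
      refine Nat.le_of_mul_le_mul_left (le_trans ?_ hpop) (by omega : 0 < 4 * k)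
      refine le_trans ?_ h₁
      have hc : s * (t + k ^ (2 * s) + 1) + (d + 2 * s)
          ≤ (s * (t + 2) + d + 2 * s) * k ^ (2 * s) := by
        have := Nat.mul_le_mul_left (s * (t + 1) + d + 2 * s) hks
        nlinarith
      have := Nat.mul_le_mul_left (4 * k) hc
      rw [pow_succ]
      nlinarith
    omega
  -- Enumerate the remaining vertices of `M`.
  obtain ⟨g, hgmem, hginj⟩ : ∃ g : ℕ → ℕ, (∀ x < #(M \ B), g x ∈ M \ B) ∧
      ∀ x < #(M \ B), ∀ y < #(M \ B), g x = g y → x = y := by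
    refine ⟨fun x => if h : x < #(M \ B) then (M \ B).orderEmbOfFin rfl ⟨x, h⟩ else 0, ?_, ?_⟩
    · intro x hx
      simp only [dif_pos hx]
      exact orderEmbOfFin_mem _ _ _
    · intro x hx y hy h
      simp only [dif_pos hx, dif_pos hy] at h
      simpa using h
  let R : ℕ → ℕ → ℕ := fun i a => g (i * s + a)
  have hlt : ∀ i < t + k ^ (2 * s) + 1, ∀ a < s, i * s + a < #(M \ B) := by
    intro i hi a ha
    have : (i + 1) * s ≤ (t + k ^ (2 * s) + 1) * s := Nat.mul_le_mul_right _ hi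
    nlinarith
  -- Two of the petals inside `M` are indistinguishable to the first two petals.
  obtain ⟨a₀, ha₀, b₀, hb₀, hab, heq⟩ := exists_ne_map_eq_of_card_lt_of_maps_to
    (s := range (k ^ (2 * s) + 1))
    (t := (univ : Finset ((Fin s → Fin k) × (Fin s → Fin k))))
    (f := fun i => (fun x => f (Q i₀ x) (petalEdge d s (R (t + i))),
      fun x => f (Q j₀ x) (petalEdge d s (R (t + i)))))
    (by simp [two_mul, pow_add]) (fun _ _ => mem_univ _)
  rw [mem_range] at ha₀ hb₀
  let σ : ℕ → ℕ := fun l => if l = 2 then t + a₀ else if l = 3 then t + b₀ else l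
  have hσlt : ∀ l < t, σ l < t + k ^ (2 * s) + 1 := by
    intro l hl
    simp only [σ]
    split_ifs <;> omega
  have hσinj : ∀ l < t, ∀ l' < t, σ l = σ l' → l = l' := by
    intro l hl l' hl'
    simp only [σ]
    split_ifs <;> omega
  let P : ℕ → ℕ → ℕ := fun l => if l = 0 then Q i₀ else if l = 1 then Q j₀ else R (σ l)
  have hP0 : P 0 = Q i₀ := rfl
  have hP1 : P 1 = Q j₀ := rfl
  have hP2 : ∀ l, 2 ≤ l → P l = R (σ l) := fun l hl => by
    simp only [P]
    rw [if_neg (by omega), if_neg (by omega)]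
  have hRmem : ∀ l < t, ∀ a < s, R (σ l) a ∈ M \ B :=
    fun l hl a ha => hgmem _ (hlt _ (hσlt l hl) a ha)
  have hcases : ∀ l, l = 0 ∨ l = 1 ∨ 2 ≤ l := by omega
  have hQ0B : ∀ a < s, Q i₀ a ∈ B := fun a ha =>
    mem_union_left _ (mem_union_right _ (mem_image_of_mem _ (mem_range.2 ha)))
  have hQ1B : ∀ a < s, Q j₀ a ∈ B := fun a ha =>
    mem_union_right _ (mem_image_of_mem _ (mem_range.2 ha))
  have hQinj : ∀ i j a b, a < s → b < s → Q i a = Q j b → i = j ∧ a = b := by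
    intro i j a b ha hb h
    exact eq_and_eq_of_mul_add_eq ha hb (by simp only [Q] at h; omega)
  obtain ⟨x, hx, hrain⟩ := hf.exists_rainbow_of_petals hs
    (by have := hQn i₀ hi₀ 0 hs; omega) P
    (by
      intro l hl a ha
      rcases hcases l with rfl | rfl | h
      · exact hQn i₀ hi₀ a ha
      · exact hQn j₀ hj₀ a ha
      · rw [hP2 l h]
        obtain ⟨hm, hb⟩ := mem_sdiff.1 (hRmem l hl a ha)
        refine ⟨?_, mem_range.1 (mem_filter.1 hm).1⟩
        by_contra! hcon
        exact hb (mem_union_left _ (mem_union_left _ (mem_range.2 hcon))))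
    (by
      intro l hl a ha l' hl' b hb h
      rcases hcases l with rfl | rfl | h1 <;> rcases hcases l' with rfl | rfl | h2
      · exact ⟨rfl, (hQinj _ _ _ _ ha hb h).2⟩
      · exact absurd (hQinj _ _ _ _ ha hb h).1 hne
      · rw [hP0, hP2 l' h2] at h
        exact absurd (h ▸ hQ0B a ha) (mem_sdiff.1 (hRmem l' hl' b hb)).2
      · exact absurd (hQinj _ _ _ _ ha hb h).1.symm hne
      · exact ⟨rfl, (hQinj _ _ _ _ ha hb h).2⟩
      · rw [hP1, hP2 l' h2] at h
        exact absurd (h ▸ hQ1B a ha) (mem_sdiff.1 (hRmem l' hl' b hb)).2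
      · rw [hP0, hP2 l h1] at h
        exact absurd (h ▸ hQ0B b hb) (mem_sdiff.1 (hRmem l hl a ha)).2
      · rw [hP1, hP2 l h1] at h
        exact absurd (h ▸ hQ1B b hb) (mem_sdiff.1 (hRmem l hl a ha)).2
      · rw [hP2 l h1, hP2 l' h2] at h
        have h3 := hginj _ (hlt _ (hσlt l hl) a ha) _ (hlt _ (hσlt l' hl') b hb) h
        obtain ⟨h4, h5⟩ := eq_and_eq_of_mul_add_eq ha hb h3
        exact ⟨hσinj l hl l' hl' h4, h5⟩)
  have h01 : f x (petalEdge d s (Q i₀)) ≠ f x (petalEdge d s (Q j₀)) := fun h =>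
    absurd (hrain 0 (by omega) 1 (by omega) h) (by omega)
  have h23 : f x (petalEdge d s (R (t + a₀))) ≠ f x (petalEdge d s (R (t + b₀))) := fun h =>
    absurd (hrain 2 (by omega) 3 (by omega) h) (by omega)
  rcases hx with hx | ⟨l, hl, a, ha, rfl⟩
  · exact h01 (((hIprop i₀ hi₀).2 x hx).trans ((hIprop j₀ hj₀).2 x hx).symm)
  · rcases hcases l with rfl | rfl | h
    · exact h23 (congrFun (congrArg Prod.fst heq) ⟨a, ha⟩)
    · exact h23 (congrFun (congrArg Prod.snd heq) ⟨a, ha⟩)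
    · rw [hP2 l h] at h01
      exact h01 (mem_filter.1 (mem_sdiff.1 (hRmem l hl a ha)).1).2

/-- A bound `k < C⁻¹ * n ^ (1 / m)` with `1 ≤ C` can be raised to the `m`-th power. -/
lemma mul_pow_le_of_lt_inv_mul_rpow {C k n m : ℕ} (hC : 1 ≤ C) (hm : m ≠ 0) {e : ℝ}
    (he : e = 1 / (m : ℝ)) (h : (k : ℝ) < (C : ℝ)⁻¹ * (n : ℝ) ^ e) : C * k ^ m ≤ n := by
  have hC' : (1 : ℝ) ≤ C := by exact_mod_cast hC
  have h1 : (C : ℝ) * k ≤ (n : ℝ) ^ e := by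
    have := mul_le_mul_of_nonneg_left h.le (by positivity : (0 : ℝ) ≤ C)
    rwa [mul_inv_cancel_left₀ (by positivity)] at this
  have h2 : ((C : ℝ) * k) ^ m ≤ n := by
    have := pow_le_pow_left₀ (by positivity) h1 m
    rwa [he, one_div, Real.rpow_inv_natCast_pow (by positivity) hm] at this
  have h3 : (C : ℝ) * k ^ m ≤ n := by
    refine le_trans ?_ h2
    rw [mul_pow]
    exact mul_le_mul_of_nonneg_right (le_self_pow₀ hC' hm) (by positivity)
  exact_mod_cast h3

theorem stmt_14 (t r d : ℕ) (ht : 4 ≤ t) (hr : 3 ≤ r) (hd : d ≤ r - 1) :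
    ∃ c : ℝ, 0 < c ∧ ∃ n₀ : ℕ, ∀ n : ℕ, n₀ ≤ n →
      min (c * (n : ℝ) ^ ((1 : ℝ) / (2 * ((r : ℝ) - (d : ℝ)) + 1)))
          (c * (n : ℝ) ^ ((1 : ℝ) / ((d : ℝ) + 1)))
        ≤ (localC n (sunflowerH r d t) : ℝ) := by
  obtain ⟨s, rfl⟩ : ∃ s, r = d + s := ⟨r - d, by omega⟩
  have hs : 0 < s := by omega
  set C := 4 * s * (t + 2) + 4 * d + 8 * s with hCdef
  have hC : 1 ≤ C := by omega
  refine ⟨(C : ℝ)⁻¹, by positivity, 0, fun n _ => ?_⟩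
  obtain ⟨f, hf⟩ := Nat.sInf_mem (exists_isLocalColoring n (sunflowerH (d + s) d t)
    ⟨1, by
      have : 0 < t * s := by positivity
      simp only [sunflowerH, Nat.add_sub_cancel_left, mem_Icc]
      omega⟩
    (by
      intro e he x hx
      simp only [sunflowerH, Nat.add_sub_cancel_left, mem_image, mem_Icc] at he ⊢
      obtain ⟨i, hi, rfl⟩ := he
      have : i * s ≤ t * s := Nat.mul_le_mul_right _ hi.2
      simp only [mem_union, mem_Icc] at hx
      omega))
  by_contra! hlt
  obtain ⟨h1, h2⟩ := lt_min_iff.1 hlt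
  refine not_isLocalColoring_sunflowerH hs ht (f 0 ∅).pos
    (mul_pow_le_of_lt_inv_mul_rpow hC (by omega) ?_ h1)
    (mul_pow_le_of_lt_inv_mul_rpow hC (by omega) ?_ h2) f hf
  · push_cast
    ring
  · push_cast
    ring
end

section
/- For all integers t ≥ 4 and r ≥ 3, there exist a constant c > 0 and an n_0 such that for all n ≥ n_0, C_r(n, M_t) ≥ c · n^{1/(2r+1)}, where M_t is the r-uniform t-matching. -/
open Finset

/-- The `r`-uniform `t`-matching `M_t`: `t` pairwise disjoint edges of size `r`. -/
def matchingH (r t : ℕ) : HGraph :=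
  ⟨Finset.Icc 1 (r * t),
   (Finset.Icc 1 t).image fun i => Finset.Icc ((i - 1) * r + 1) (i * r)⟩

/-- A colouring of `2 * k` objects with `k` colours has at least `k` ordered monochromatic pairs. -/
lemma le_card_monochromatic_pairs {k : ℕ} (h : ℕ → Fin k) :
    k ≤ #{p ∈ (range (2 * k)).offDiag | h p.1 = h p.2} := by
  classical
  set L := {i ∈ range (2 * k) | ∃ j ∈ range (2 * k), i ≠ j ∧ h i = h j}
  have h1 : #L ≤ #{p ∈ (range (2 * k)).offDiag | h p.1 = h p.2} := by
    refine (card_le_card ?_).trans (card_image_le (f := Prod.fst))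
    intro i hi
    obtain ⟨hi, j, hj, hij, hh⟩ := mem_filter.1 hi
    exact mem_image.2 ⟨(i, j), mem_filter.2 ⟨mem_offDiag.2 ⟨hi, hj, hij⟩, hh⟩, rfl⟩
  have h2 : #(range (2 * k) \ L) ≤ k := by
    have := card_le_card_of_injOn (t := (univ : Finset (Fin k))) h
      (s := range (2 * k) \ L) (fun _ _ => by simp) (by
        intro a ha b hb hab
        by_contra hne
        obtain ⟨ha, haL⟩ := mem_sdiff.1 ha
        exact haL (mem_filter.2 ⟨ha, b, (mem_sdiff.1 hb).1, hne, hab⟩))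
    simpa using this
  have hLsub : L ⊆ range (2 * k) := filter_subset _ _
  have h3 := card_sdiff_add_card_eq_card hLsub
  rw [card_range] at h3
  omega

/-- Among `2 * k` objects coloured with `k` colours by each member of a set `W`,
some pair is monochromatic for a large part of `W`. -/
lemma exists_popular_pair_s15 {k s : ℕ} (hk : 0 < k) (hs : 0 < s) (W : Finset ℕ)
    (hW : 4 * k * s ≤ #W) (h : ℕ → ℕ → Fin k) :
    ∃ i j, i < 2 * k ∧ j < 2 * k ∧ i ≠ j ∧ s ≤ #{u ∈ W | h u i = h u j} := by
  classical
  by_contra! hcon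
  have key := card_mul_le_card_mul (s := W) (t := (range (2 * k)).offDiag)
    (fun u p => h u p.1 = h u p.2) (m := k) (n := s - 1)
    (fun u _ => le_card_monochromatic_pairs (h u)) (by
      intro p hp
      rw [mem_offDiag, mem_range, mem_range] at hp
      have := hcon p.1 p.2 hp.1 hp.2.1 hp.2.2
      exact Nat.le_sub_one_of_lt this)
  rw [offDiag_card, card_range] at key
  have h1 : (2 * k * (2 * k) - 2 * k) * (s - 1) ≤ 4 * k * k * (s - 1) :=
    Nat.mul_le_mul_right _ ((Nat.sub_le _ _).trans (by nlinarith))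
  have h2 : 4 * k * k * (s - 1) < 4 * k * k * s :=
    Nat.mul_lt_mul_of_pos_left (by omega) (by positivity)
  nlinarith [Nat.mul_le_mul_right k hW]

/-- A local colouring of a matching, expressed through families of disjoint `r`-sets. -/
lemma IsLocalColoring.exists_rainbow {n k r t : ℕ} {f : ℕ → Finset ℕ → Fin k} (hr : 0 < r)
    (hf : IsLocalColoring n k (matchingH r t) f) (E : ℕ → Finset ℕ)
    (hcard : ∀ i < t, #(E i) = r) (hsub : ∀ i < t, E i ⊆ range n)
    (hdisj : ∀ i < t, ∀ j < t, i ≠ j → Disjoint (E i) (E j)) :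
    ∃ m < t, ∃ x ∈ E m, ∀ i < t, ∀ j < t, f x (E i) = f x (E j) → i = j := by
  classical
  have hg : ∀ i, ∃ g : ℕ → ℕ, i < t →
      (range r).image g = E i ∧ Set.InjOn g (range r : Finset ℕ) := by
    intro i
    by_cases hi : i < t
    · let ψ := (E i).orderEmbOfFin (hcard i hi)
      let g : ℕ → ℕ := fun y => if h : y < r then ψ ⟨y, h⟩ else 0
      have hinj : Set.InjOn g (range r : Finset ℕ) := by
        intro y hy z hz hyz
        have hy := mem_range.1 (mem_coe.1 hy)
        have hz := mem_range.1 (mem_coe.1 hz)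
        simp only [g, dif_pos hy, dif_pos hz] at hyz
        simpa using ψ.injective hyz
      refine ⟨g, fun _ => ⟨eq_of_subset_of_card_le ?_ ?_, hinj⟩⟩
      · intro x hx
        obtain ⟨y, hy, rfl⟩ := mem_image.1 hx
        simp only [g, dif_pos (mem_range.1 hy)]
        exact orderEmbOfFin_mem _ _ _
      · rw [card_image_of_injOn hinj, hcard i hi, card_range]
    · exact ⟨id, fun h => absurd h hi⟩
  choose g hg using hg
  set φ : ℕ → ℕ := fun v => g ((v - 1) / r) ((v - 1) % r) with hφ
  have hdiv : ∀ v ∈ Icc 1 (r * t), (v - 1) / r < t := by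
    intro v hv
    rw [mem_Icc] at hv
    rw [Nat.div_lt_iff_lt_mul hr, mul_comm]
    omega
  have hmod : ∀ v : ℕ, (v - 1) % r ∈ range r := fun v => mem_range.2 (Nat.mod_lt _ hr)
  have hmem : ∀ v ∈ Icc 1 (r * t), φ v ∈ E ((v - 1) / r) := by
    intro v hv
    rw [← (hg _ (hdiv v hv)).1]
    exact mem_image_of_mem _ (hmod v)
  have himg : ∀ i < t, (Icc (i * r + 1) ((i + 1) * r)).image φ = E i := by
    intro i hi
    rw [← (hg i hi).1]
    ext y
    simp only [mem_image, mem_Icc, mem_range]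
    constructor
    · rintro ⟨v, ⟨h1, h2⟩, rfl⟩
      have h3 : (v - 1) / r = i := by
        rw [Nat.div_eq_iff hr]
        rw [add_mul] at h2
        omega
      exact ⟨(v - 1) % r, Nat.mod_lt _ hr, by simp only [hφ, h3]⟩
    · rintro ⟨j, hj, rfl⟩
      refine ⟨i * r + j + 1, ⟨by omega, by rw [add_mul]; omega⟩, ?_⟩
      simp only [hφ, Nat.add_sub_cancel]
      rw [mul_comm i r, Nat.mul_add_div hr, Nat.div_eq_of_lt hj, Nat.mul_add_mod,
        Nat.mod_eq_of_lt hj, add_zero]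
  have hcopy : IsCopy n (matchingH r t) φ := by
    refine ⟨?_, fun v hv => hsub _ (hdiv v hv) (hmem v hv)⟩
    intro v hv w hw hvw
    have hv' : v ∈ Icc 1 (r * t) := hv
    have hw' : w ∈ Icc 1 (r * t) := hw
    have hd : (v - 1) / r = (w - 1) / r := by
      by_contra hne
      exact disjoint_left.1 (hdisj _ (hdiv v hv') _ (hdiv w hw') hne) (hmem v hv')
        (hvw ▸ hmem w hw')
    have hm : (v - 1) % r = (w - 1) % r := by
      refine (hg _ (hdiv v hv')).2 (hmod v) (hmod w) ?_
      simpa only [hφ, ← hd] using hvw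
    have h1 := Nat.div_add_mod (v - 1) r
    have h2 := Nat.div_add_mod (w - 1) r
    rw [hd, hm, h2] at h1
    rw [mem_Icc] at hv' hw'
    omega
  obtain ⟨x, hx, hrain⟩ := hf φ hcopy
  have hedge : ∀ i < t, Icc (i * r + 1) ((i + 1) * r) ∈ (matchingH r t).edges := by
    intro i hi
    exact mem_image.2 ⟨i + 1, mem_Icc.2 ⟨by omega, hi⟩, by simp⟩
  refine ⟨_, hdiv x hx, φ x, hmem x hx, fun i hi j hj hij => ?_⟩
  have heq := hrain _ (hedge i hi) _ (hedge j hj) (by rwa [himg i hi, himg j hj])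
  by_contra hne
  have hself := hdisj i hi j hj hne
  rw [← himg i hi, ← himg j hj, heq, himg j hj, disjoint_self_iff_empty] at hself
  have := hcard j hj
  rw [hself, card_empty] at this
  omega

/-- The polynomial upper bound on `n` in terms of the number of colours. -/
lemma IsLocalColoring.lt_of_matchingH {n k r t : ℕ} {f : ℕ → Finset ℕ → Fin k}
    (hr : 0 < r) (ht : 4 ≤ t) (hf : IsLocalColoring n k (matchingH r t) f) :
    n < 2 * k * r + 4 * k * (r * (k ^ (2 * r) + t)) := by
  classical
  by_contra! hn
  have hk : 0 < k := (Nat.zero_le _).trans_lt (f 0 ∅).isLt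
  set N := k ^ (2 * r) + t with hN
  let A : ℕ → Finset ℕ := fun i => Ico (i * r) ((i + 1) * r)
  have hAdisj : ∀ i j, i ≠ j → Disjoint (A i) (A j) := by
    intro i j hij
    rw [disjoint_left]
    intro x hx hy
    simp only [A, mem_Ico] at hx hy
    apply hij
    rw [← Nat.div_eq_of_lt_le hx.1 hx.2, ← Nat.div_eq_of_lt_le hy.1 hy.2]
  have hAcard : ∀ i, #(A i) = r := by
    intro i
    simp only [A, Nat.card_Ico, add_mul]
    omega
  obtain ⟨i, j, hi, hj, hij, hU⟩ := exists_popular_pair_s15 (s := r * N) hk (by positivity)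
    (Ico (2 * k * r) n) (by rw [Nat.card_Ico]; omega) (fun u i => f u (A i))
  set U := {u ∈ Ico (2 * k * r) n | f u (A i) = f u (A j)}
  obtain ⟨V, hVU, hVcard⟩ := exists_subset_card_eq hU
  let ψ := V.orderEmbOfFin hVcard
  let B : ℕ → Finset ℕ := fun a => {x ∈ V | ∃ y : Fin (r * N), ψ y = x ∧ (y : ℕ) ∈ A a}
  have hBcard : ∀ a < N, #(B a) = r := by
    intro a ha
    have hlt : ∀ y ∈ A a, y < r * N := by
      intro y hy
      have hy := (mem_Ico.1 hy).2
      have : (a + 1) * r ≤ N * r := Nat.mul_le_mul_right _ ha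
      rw [mul_comm r]
      omega
    rw [← hAcard a]
    symm
    refine card_bij (fun y hy => ψ ⟨y, hlt y hy⟩) ?_ ?_ ?_
    · intro y hy
      exact mem_filter.2 ⟨orderEmbOfFin_mem _ _ _, _, rfl, hy⟩
    · intro y hy z hz h
      simpa using ψ.injective h
    · intro x hx
      obtain ⟨-, y, rfl, hy⟩ := mem_filter.1 hx
      exact ⟨y, hy, rfl⟩
  have hBdisj : ∀ a b, a ≠ b → Disjoint (B a) (B b) := by
    intro a b hab
    rw [disjoint_left]
    intro x hx hy
    obtain ⟨-, y, hyx, hya⟩ := mem_filter.1 hx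
    obtain ⟨-, z, hzx, hzb⟩ := mem_filter.1 hy
    have : y = z := ψ.injective (hyx.trans hzx.symm)
    subst this
    exact disjoint_left.1 (hAdisj a b hab) hya hzb
  have hBU : ∀ a, B a ⊆ U := fun a => (filter_subset _ _).trans hVU
  have hAlt : ∀ i < 2 * k, ∀ x ∈ A i, x < 2 * k * r := by
    intro i hi x hx
    have := (mem_Ico.1 hx).2
    have : (i + 1) * r ≤ 2 * k * r := Nat.mul_le_mul_right _ hi
    omega
  have hAB : ∀ i < 2 * k, ∀ a, Disjoint (A i) (B a) := by
    intro i hi a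
    rw [disjoint_left]
    intro x hx hy
    have h1 := (mem_Ico.1 (mem_filter.1 (hBU a hy)).1).1
    have h2 := hAlt i hi x hx
    omega
  obtain ⟨a, ha, b, hb, hab, hcol⟩ := exists_ne_map_eq_of_card_lt_of_maps_to
    (s := range N) (t := (univ : Finset ((A i ∪ A j : Finset ℕ) → Fin k)))
    (f := fun a u => f u (B a)) (by
      rw [card_univ, Fintype.card_fun, Fintype.card_coe, Fintype.card_fin, card_range,
        card_union_of_disjoint (hAdisj i j hij), hAcard, hAcard, ← two_mul]
      omega) (fun _ _ => by simp)
  rw [mem_range] at ha hb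
  obtain ⟨σ, hσ0, hσ1, hσ⟩ : ∃ σ : Equiv.Perm ℕ, σ 0 = a ∧ σ 1 = b ∧ ∀ m < N, σ m < N := by
    have hswap : ∀ p < N, ∀ q < N, ∀ m < N, Equiv.swap p q m < N := by
      intro p hp q hq m hm
      rw [Equiv.swap_apply_def]
      split_ifs <;> assumption
    have h0 : 0 < N := by omega
    have hx : Equiv.swap 0 a b ≠ 0 := by
      intro h
      rw [Equiv.swap_apply_eq_iff, Equiv.swap_apply_left] at h
      exact hab h.symm
    refine ⟨(Equiv.swap 1 (Equiv.swap 0 a b)).trans (Equiv.swap 0 a), ?_, ?_, ?_⟩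
    · rw [Equiv.trans_apply, Equiv.swap_apply_of_ne_of_ne (by omega) hx.symm,
        Equiv.swap_apply_left]
    · rw [Equiv.trans_apply, Equiv.swap_apply_left, Equiv.swap_apply_self]
    · intro m hm
      exact hswap _ h0 _ ha _ (hswap _ (by omega) _ (hswap _ h0 _ ha _ hb) _ hm)
  let E : ℕ → Finset ℕ
    | 0 => A i
    | 1 => A j
    | m + 2 => B (σ m)
  have hσt : ∀ m, m + 2 < t → σ m < N := fun m hm => hσ m (by omega)
  have hAn : ∀ i < 2 * k, A i ⊆ range n := by
    intro i hi x hx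
    have := hAlt i hi x hx
    rw [mem_range]
    omega
  obtain ⟨m, hm, x, hx, hrain⟩ := hf.exists_rainbow hr E
    (by
      rintro (_ | _ | m) hm
      exacts [hAcard i, hAcard j, hBcard _ (hσt m hm)])
    (by
      rintro (_ | _ | m) hm
      · exact hAn i hi
      · exact hAn j hj
      · intro x hx
        exact mem_range.2 (mem_Ico.1 (mem_filter.1 (hBU _ hx)).1).2)
    (by
      rintro (_ | _ | p) hp (_ | _ | q) hq hpq
      · exact absurd rfl hpq
      · exact hAdisj i j hij
      · exact hAB i hi _
      · exact hAdisj j i hij.symm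
      · exact absurd rfl hpq
      · exact hAB j hj _
      · exact (hAB i hi _).symm
      · exact (hAB j hj _).symm
      · exact hBdisj _ _ (fun h => hpq (by rw [σ.injective h])))
  have hAx : x ∈ A i ∪ A j → False := by
    intro hx
    have h := congrFun hcol ⟨x, hx⟩
    have := hrain 2 (by omega) 3 (by omega) (by
      change f x (B (σ 0)) = f x (B (σ 1))
      rw [hσ0, hσ1]
      exact h)
    omega
  rcases m with _ | _ | m
  · exact hAx (mem_union_left _ hx)
  · exact hAx (mem_union_right _ hx)
  · have := hrain 0 (by omega) 1 (by omega) (mem_filter.1 (hBU _ hx)).2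
    omega

/-- Enough colours always admit a local colouring of a nonempty matching. -/
lemma exists_isLocalColoring_matchingH (n : ℕ) {r t : ℕ} (hr : 0 < r) (ht : 0 < t) :
    ∃ k, ∃ f : ℕ → Finset ℕ → Fin k, IsLocalColoring n k (matchingH r t) f := by
  classical
  let ι := (range n).powerset
  let e := Fintype.equivFin ι
  refine ⟨Fintype.card ι, fun _ s => e ⟨s ∩ range n, by simp [ι]⟩, fun φ hφ => ?_⟩
  refine ⟨1, mem_Icc.2 ⟨le_rfl, Nat.mul_pos hr ht⟩, fun e₁ h₁ e₂ h₂ h => ?_⟩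
  have hsub : ∀ e ∈ (matchingH r t).edges, e ⊆ (matchingH r t).verts := by
    intro e he
    obtain ⟨i, hi, rfl⟩ := mem_image.1 he
    refine Icc_subset_Icc (by omega) ?_
    rw [mul_comm]
    exact Nat.mul_le_mul_left _ (mem_Icc.1 hi).2
  have himg : ∀ e ∈ (matchingH r t).edges, e.image φ ∩ range n = e.image φ := by
    intro e he
    refine inter_eq_left.2 (image_subset_iff.2 fun v hv => hφ.2 v (hsub e he hv))
  have h' := congrArg Subtype.val (e.injective h)
  simp only [himg e₁ h₁, himg e₂ h₂] at h'
  have h'' : φ '' (e₁ : Set ℕ) = φ '' (e₂ : Set ℕ) := by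
    rw [← coe_image, ← coe_image, h']
  exact coe_injective ((hφ.1.image_eq_image_iff (coe_subset.2 (hsub e₁ h₁))
    (coe_subset.2 (hsub e₂ h₂))).1 h'')

theorem stmt_15 (t r : ℕ) (ht : 4 ≤ t) (hr : 3 ≤ r) :
    ∃ c : ℝ, 0 < c ∧ ∃ n₀ : ℕ, ∀ n : ℕ, n₀ ≤ n →
      c * (n : ℝ) ^ ((1 : ℝ) / (2 * (r : ℝ) + 1)) ≤ (localC n (matchingH r t) : ℝ) := by
  have hr0 : 0 < r := by omega
  set C : ℕ := 2 * r + 4 * r * (1 + t) with hC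
  have hCpos : (0 : ℝ) < C := by
    have : 0 < C := by omega
    exact_mod_cast this
  set p : ℝ := (1 : ℝ) / (2 * (r : ℝ) + 1) with hp
  have hp0 : 0 ≤ p := by positivity
  refine ⟨((C : ℝ)⁻¹) ^ p, by positivity, 0, fun n _ => ?_⟩
  obtain ⟨f, hf⟩ := Nat.sInf_mem (exists_isLocalColoring_matchingH n hr0 (by omega : 0 < t))
  change IsLocalColoring n (localC n (matchingH r t)) _ f at hf
  have hk : 0 < localC n (matchingH r t) := (Nat.zero_le _).trans_lt (f 0 ∅).isLt
  have hlt := hf.lt_of_matchingH hr0 ht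
  generalize localC n (matchingH r t) = k at hk hlt
  have hle : n ≤ C * k ^ (2 * r + 1) := by
    have h1 : 1 ≤ k ^ (2 * r) := Nat.one_le_pow _ _ hk
    have h2 : r * k ≤ r * k * k ^ (2 * r) := Nat.le_mul_of_pos_right _ h1
    have h3 : r * k * t ≤ r * k * t * k ^ (2 * r) := Nat.le_mul_of_pos_right _ h1
    rw [pow_succ, hC]
    nlinarith
  have hle' : (C : ℝ)⁻¹ * n ≤ (k : ℝ) ^ (2 * r + 1) := by
    rw [inv_mul_le_iff₀ hCpos]
    exact_mod_cast hle
  rw [← Real.mul_rpow (by positivity) (by positivity)]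
  refine (Real.rpow_le_rpow (by positivity) hle' hp0).trans (le_of_eq ?_)
  rw [← Real.rpow_natCast, ← Real.rpow_mul (by positivity)]
  have : ((2 * r + 1 : ℕ) : ℝ) * p = 1 := by
    rw [hp]
    push_cast
    field_simp
  rw [this, Real.rpow_one]
end

section
/- C_3(n, TC_e) = n^{o(1)}; that is, for every ε > 0 there exists an n_0 such that for all n ≥ n_0, C_3(n, TC_e) ≤ n^ε. -/
open Finset

/-- The tight 3-uniform triangle with a pendant edge, `TC_e`
(vertices `a,b,c,d,e = 0,1,2,3,4`). -/
def TCe : HGraph := ⟨{0, 1, 2, 3, 4}, {{0, 1, 3}, {1, 2, 3}, {2, 3, 4}, {0, 2, 3}}⟩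

open Polynomial

/-- The words `w x`, `x < n`, over the alphabet `{0, …, m - 1}` are pairwise distinguished by
their first `t` letters. -/
structure IsWordCode (w : ℕ → ℕ → ℕ) (m t n : ℕ) : Prop where
  lt : ∀ x i, w x i < m
  exists_ne : ∀ x < n, ∀ y < n, x ≠ y → ∃ i < t, w x i ≠ w y i

theorem exists_digit_ne (m t x y : ℕ) (hx : x < m ^ t) (hy : y < m ^ t) (hxy : x ≠ y) :
    ∃ i < t, x / m ^ i % m ≠ y / m ^ i % m := by
  induction t generalizing x y with
  | zero => simp at hx hy; omega
  | succ t ih =>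
    by_cases h : x % m = y % m
    · have hne : x / m ≠ y / m := by
        intro h'
        exact hxy (by rw [← Nat.div_add_mod x m, ← Nat.div_add_mod y m, h, h'])
      obtain ⟨i, hi, h'⟩ := ih (x / m) (y / m)
        (Nat.div_lt_of_lt_mul (by rwa [pow_succ'] at hx))
        (Nat.div_lt_of_lt_mul (by rwa [pow_succ'] at hy)) hne
      refine ⟨i + 1, by omega, ?_⟩
      rwa [pow_succ', ← Nat.div_div_eq_div_mul, ← Nat.div_div_eq_div_mul]
    · exact ⟨0, by omega, by simpa using h⟩

theorem isWordCode_digits {m t n : ℕ} (hm : 0 < m) (hn : n ≤ m ^ t) :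
    IsWordCode (fun x i => x / m ^ i % m) m t n where
  lt _ _ := Nat.mod_lt _ hm
  exists_ne x hx y hy hxy := exists_digit_ne m t x y (hx.trans_le hn) (hy.trans_le hn) hxy

/-- The first position at which the words of `x` and `y` differ. -/
noncomputable def firstDiff (w : ℕ → ℕ → ℕ) (x y : ℕ) : ℕ := sInf {i | w x i ≠ w y i}

theorem firstDiff_comm (w : ℕ → ℕ → ℕ) (x y : ℕ) : firstDiff w x y = firstDiff w y x := by
  simp only [firstDiff, ne_comm]

theorem eq_of_lt_firstDiff {w : ℕ → ℕ → ℕ} {x y i : ℕ} (h : i < firstDiff w x y) :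
    w x i = w y i := by
  by_contra hne
  exact Nat.notMem_of_lt_sInf h hne

/-- The branch, in the tree of words, along which `x` leaves the word of `v`; encoded by the
position of the first difference and the letter of `x` there. -/
noncomputable def branch (w : ℕ → ℕ → ℕ) (m t p v x : ℕ) : ZMod p :=
  if x = v then ((t * m : ℕ) : ZMod p)
  else ((firstDiff w v x * m + w x (firstDiff w v x) : ℕ) : ZMod p)

/-- The polynomial whose coefficients are the first `t` letters of `x`. -/
noncomputable def wordPoly (w : ℕ → ℕ → ℕ) (t p x : ℕ) : (ZMod p)[X] :=
  ∑ i ∈ range t, C (w x i : ZMod p) * X ^ i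

/-- For each position-letter pair encoded by a point where the polynomials of `x` and
`v` agree, whether `y` has this letter at this position. -/
noncomputable def matchBits (w : ℕ → ℕ → ℕ) (m t p v x y : ℕ) [Fact p.Prime] :
    Fin t → ZMod 2 := fun i =>
  if w y (((wordPoly w t p x - wordPoly w t p v).roots.toList.getD i 0).val / m) =
    ((wordPoly w t p x - wordPoly w t p v).roots.toList.getD i 0).val % m then 1 else 0

/-- The colour that `v` gives to the edge `E`. -/
noncomputable def localColor (w : ℕ → ℕ → ℕ) (m t p v : ℕ) [Fact p.Prime] (E : Finset ℕ) :
    ZMod p × Multiset (ZMod p × ZMod p × (Fin t → ZMod 2)) :=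
  (∑ x ∈ E, ∑ y ∈ E, (firstDiff w x y : ZMod p),
    E.val.map fun x => (branch w m t p v x,
      ∑ y ∈ E, (wordPoly w t p y).eval (branch w m t p v x), ∑ y ∈ E, matchBits w m t p v x y))

theorem natCast_zmod_inj {p a b : ℕ} (ha : a < p) (hb : b < p) (h : (a : ZMod p) = b) :
    a = b := by
  have := (ZMod.natCast_eq_natCast_iff' a b p).1 h
  rwa [Nat.mod_eq_of_lt ha, Nat.mod_eq_of_lt hb] at this

section

variable {w : ℕ → ℕ → ℕ} {m t n p : ℕ}

theorem IsWordCode.firstDiff_spec (hw : IsWordCode w m t n) {x y : ℕ} (hx : x < n) (hy : y < n)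
    (hxy : x ≠ y) :
    firstDiff w x y < t ∧ w x (firstDiff w x y) ≠ w y (firstDiff w x y) := by
  obtain ⟨i, hi, h⟩ := hw.exists_ne x hx y hy hxy
  exact ⟨(Nat.sInf_le h).trans_lt hi, Nat.sInf_mem (s := {i | w x i ≠ w y i}) ⟨i, h⟩⟩

theorem IsWordCode.min_firstDiff_le (hw : IsWordCode w m t n) {x z : ℕ} (y : ℕ) (hx : x < n)
    (hz : z < n) (hxz : x ≠ z) :
    min (firstDiff w x y) (firstDiff w y z) ≤ firstDiff w x z := by
  by_contra! h
  rw [lt_min_iff] at h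
  exact (hw.firstDiff_spec hx hz hxz).2
    ((eq_of_lt_firstDiff h.1).trans (eq_of_lt_firstDiff h.2))

theorem IsWordCode.code_lt (hw : IsWordCode w m t n) {v x : ℕ} (hv : v < n) (hx : x < n)
    (hvx : v ≠ x) : firstDiff w v x * m + w x (firstDiff w v x) < t * m := by
  have h1 := (hw.firstDiff_spec hv hx hvx).1
  have h2 := hw.lt x (firstDiff w v x)
  nlinarith

theorem IsWordCode.eq_of_branch_self_eq (hw : IsWordCode w m t n) (hp : t * m < p) {v x : ℕ}
    (hv : v < n) (hx : x < n) (h : branch w m t p v v = branch w m t p v x) : x = v := by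
  by_contra hne
  simp only [branch, if_true, if_neg hne] at h
  have h1 := hw.code_lt hv hx (Ne.symm hne)
  have := natCast_zmod_inj hp (h1.trans hp) h
  omega

theorem IsWordCode.firstDiff_lt_of_branch_eq (hw : IsWordCode w m t n) (hp : t * m < p)
    {v x y : ℕ} (hv : v < n) (hx : x < n) (hy : y < n) (hxv : x ≠ v) (hyv : y ≠ v) (hxy : x ≠ y)
    (h : branch w m t p v x = branch w m t p v y) :
    firstDiff w v x = firstDiff w v y ∧ firstDiff w v x < firstDiff w x y := by
  simp only [branch, if_neg hxv, if_neg hyv] at h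
  have h' := natCast_zmod_inj ((hw.code_lt hv hx hxv.symm).trans hp)
    ((hw.code_lt hv hy hyv.symm).trans hp) h
  have hlx := hw.lt x (firstDiff w v x)
  have hly := hw.lt y (firstDiff w v y)
  have hm : 0 < m := by omega
  have hd : firstDiff w v x = firstDiff w v y := by
    have := congrArg (· / m) h'
    simpa [mul_comm _ m, Nat.mul_add_div hm, Nat.div_eq_of_lt hlx, Nat.div_eq_of_lt hly] using this
  refine ⟨hd, ?_⟩
  have hle := hw.min_firstDiff_le v hx hy hxy
  rw [firstDiff_comm w x v] at hle
  refine lt_of_le_of_ne (by omega) fun he => (hw.firstDiff_spec hx hy hxy).2 ?_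
  rw [← he]
  rw [← hd] at h'
  omega

theorem coeff_wordPoly (x i : ℕ) (hi : i < t) : (wordPoly w t p x).coeff i = w x i := by
  simp [wordPoly, finsetSum_coeff, coeff_X_pow, hi]

theorem natDegree_wordPoly_lt [Fact p.Prime] (ht : 0 < t) (x : ℕ) :
    (wordPoly w t p x).natDegree < t := by
  refine (Nat.lt_iff_le_pred ht).2 (natDegree_sum_le_of_forall_le _ _ fun i hi => ?_)
  exact (natDegree_C_mul_X_pow_le _ _).trans (Nat.le_pred_of_lt (mem_range.1 hi))

theorem IsWordCode.wordPoly_sub_ne_zero (hw : IsWordCode w m t n) (hp : m ≤ p)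
    {x y : ℕ} (hx : x < n) (hy : y < n) (hxy : x ≠ y) :
    wordPoly w t p x - wordPoly w t p y ≠ 0 := by
  intro h
  obtain ⟨i, hi, hne⟩ := hw.exists_ne x hx y hy hxy
  have := congrArg (fun q => coeff q i) (sub_eq_zero.1 h)
  simp only [coeff_wordPoly _ _ hi] at this
  exact hne (natCast_zmod_inj ((hw.lt _ _).trans_le hp) ((hw.lt _ _).trans_le hp) this)

section

variable [Fact p.Prime]

/-- The bits of `y` and `z` relative to `v` and `x` differ as soon as the polynomials of `v` and
`x` agree at the branch leading from `y` to `z`. -/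
theorem IsWordCode.matchBits_ne (hw : IsWordCode w m t n) (hp : t * m < p) {v x y z : ℕ}
    (hv : v < n) (hx : x < n) (hy : y < n) (hz : z < n) (hvx : x ≠ v) (hyz : y ≠ z)
    (h : (wordPoly w t p x).eval (branch w m t p y z) =
      (wordPoly w t p v).eval (branch w m t p y z)) :
    matchBits w m t p v x y ≠ matchBits w m t p v x z := by
  have ht : 0 < t := by have := (hw.firstDiff_spec hx hv hvx).1; omega
  have hm : 0 < m := (Nat.zero_le _).trans_lt (hw.lt 0 0)
  have hne := hw.wordPoly_sub_ne_zero (p := p) (by nlinarith) hx hv hvx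
  set q := wordPoly w t p x - wordPoly w t p v with hq
  have hdeg : q.roots.toList.length < t := by
    rw [Multiset.length_toList]
    refine (card_roots' q).trans_lt ((natDegree_sub_le _ _).trans_lt ?_)
    exact max_lt (natDegree_wordPoly_lt ht _) (natDegree_wordPoly_lt ht _)
  have hroot : branch w m t p y z ∈ q.roots.toList := by
    rw [Multiset.mem_toList, mem_roots hne, IsRoot, hq, eval_sub, h, sub_self]
  obtain ⟨i, hi, hget⟩ := List.getElem_of_mem hroot
  intro heq
  have := congrFun heq ⟨i, hi.trans hdeg⟩
  have hval : (branch w m t p y z).val = firstDiff w y z * m + w z (firstDiff w y z) := by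
    rw [branch, if_neg hyz.symm, ZMod.val_natCast, Nat.mod_eq_of_lt]
    exact (hw.code_lt hy hz hyz).trans hp
  have hlt := hw.lt z (firstDiff w y z)
  have hdiv : (firstDiff w y z * m + w z (firstDiff w y z)) / m = firstDiff w y z := by
    rw [mul_comm, Nat.mul_add_div hm, Nat.div_eq_of_lt hlt, add_zero]
  have hmod : (firstDiff w y z * m + w z (firstDiff w y z)) % m = w z (firstDiff w y z) := by
    rw [mul_comm, Nat.mul_add_mod, Nat.mod_eq_of_lt hlt]
  simp only [matchBits, ← hq, List.getD_eq_getElem _ _ hi, hget, hval, hdiv, hmod, if_true,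
    if_neg (hw.firstDiff_spec hy hz hyz).2] at this
  exact zero_ne_one this

theorem exists_mem_of_localColor_eq {v x : ℕ} {E E' : Finset ℕ}
    (h : localColor w m t p v E = localColor w m t p v E') (hx : x ∈ E) :
    ∃ x' ∈ E', branch w m t p v x = branch w m t p v x' ∧
      ∑ y ∈ E, (wordPoly w t p y).eval (branch w m t p v x) =
        ∑ y ∈ E', (wordPoly w t p y).eval (branch w m t p v x) ∧
      ∑ y ∈ E, matchBits w m t p v x y = ∑ y ∈ E', matchBits w m t p v x' y := by
  have h2 := (Prod.ext_iff.1 h).2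
  simp only [localColor] at h2
  have hmem := Multiset.mem_map_of_mem (fun x => (branch w m t p v x,
    ∑ y ∈ E, (wordPoly w t p y).eval (branch w m t p v x),
    ∑ y ∈ E, matchBits w m t p v x y)) (s := E.val) hx
  rw [h2, Multiset.mem_map] at hmem
  obtain ⟨x', hx', he⟩ := hmem
  simp only [Prod.mk.injEq] at he
  obtain ⟨h3, h4, h5⟩ := he
  exact ⟨x', hx', h3.symm, by rw [← h4, h3], h5.symm⟩

theorem IsWordCode.mem_of_localColor_eq (hw : IsWordCode w m t n) (hp : t * m < p) {v : ℕ}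
    {E E' : Finset ℕ} (hE : ∀ x ∈ E', x < n) (hv : v < n)
    (h : localColor w m t p v E = localColor w m t p v E') (hvE : v ∈ E) : v ∈ E' := by
  obtain ⟨x', hx', h1, -⟩ := exists_mem_of_localColor_eq h hvE
  rwa [← hw.eq_of_branch_self_eq hp hv (hE x' hx') h1]

theorem branch_eq_of_localColor_insert_eq {v x y : ℕ} {R : Finset ℕ} (hx : x ∉ R) (hy : y ∉ R)
    (h : localColor w m t p v (insert x R) = localColor w m t p v (insert y R)) :
    branch w m t p v x = branch w m t p v y := by
  have h2 := congrArg (Multiset.map Prod.fst) (Prod.ext_iff.1 h).2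
  simpa [localColor, Finset.insert_val_of_notMem, hx, hy] using h2

/-- In the configuration where the words of `b, c` and of `a, e` branch off from each other, one of
`b` and `e` sees a rainbow copy. -/
theorem IsWordCode.false_of_localColor_eq (hw : IsWordCode w m t n) (hp : t * m < p) (hm : 2 ≤ m)
    {a b c d e : ℕ} (ha : a < n) (hb : b < n) (hc : c < n) (hd : d < n) (he : e < n)
    (hnd : [a, b, c, d, e].Nodup)
    (hbr : branch w m t p a b = branch w m t p a c)
    (hcol : localColor w m t p b {a, c, d} = localColor w m t p b {e, c, d})
    (hcole : localColor w m t p e {a, b, d} = localColor w m t p e {c, b, d} ∨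
      localColor w m t p e {b, a, d} = localColor w m t p e {c, a, d} ∨
      localColor w m t p e {b, c, d} = localColor w m t p e {a, c, d}) : False := by
  simp only [List.nodup_cons, List.mem_cons, List.not_mem_nil, or_false, not_or,
    not_false_eq_true, List.nodup_nil, and_true] at hnd
  obtain ⟨⟨hab, hac, had, hae⟩, ⟨hbc, hbd, hbe⟩, ⟨hcd, hce⟩, hde⟩ := hnd
  have hae_b := branch_eq_of_localColor_insert_eq (by simp [*]) (by simp; tauto) hcol
  obtain ⟨h1, h2⟩ := hw.firstDiff_lt_of_branch_eq hp ha hb hc (Ne.symm hab) (Ne.symm hac) hbc hbr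
  obtain ⟨h3, h4⟩ := hw.firstDiff_lt_of_branch_eq hp hb ha he hab (Ne.symm hbe) hae hae_b
  rw [firstDiff_comm w b a] at h3 h4
  have hnot : ∀ x, x = b ∨ x = c → branch w m t p e a ≠ branch w m t p e x := by
    rintro x hx hbx
    have hxn : x < n := by rcases hx with rfl | rfl <;> assumption
    have hxe : x ≠ e := by rcases hx with rfl | rfl <;> assumption
    have hax : a ≠ x := by rcases hx with rfl | rfl <;> assumption
    have := (hw.firstDiff_lt_of_branch_eq hp he ha hxn hae hxe hax hbx).2
    rw [firstDiff_comm w e a] at this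
    rcases hx with rfl | rfl <;> omega
  have hcole' : localColor w m t p e {a, b, d} = localColor w m t p e {a, c, d} := by
    rcases hcole with h | h | h
    · exact absurd (branch_eq_of_localColor_insert_eq (by simp [*]) (by simp; tauto) h)
        (hnot c (.inr rfl))
    · rwa [Finset.insert_comm b, Finset.insert_comm c] at h
    · exact absurd (branch_eq_of_localColor_insert_eq (by simp [*]) (by simp [*]) h).symm
        (hnot b (.inl rfl))
  -- the position sums show that `a` and `d` do not branch off from `e` together
  have hce_p : firstDiff w c e = firstDiff w a c := by
    have u1 := hw.min_firstDiff_le a hc he hce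
    have u2 := hw.min_firstDiff_le e ha hc hac
    rw [firstDiff_comm w c a] at u1
    rw [firstDiff_comm w e c] at u2
    omega
  have hade : firstDiff w a d = firstDiff w e d := by
    have hs := (Prod.ext_iff.1 hcol).1
    simp only [localColor] at hs
    have hself : ∀ x, firstDiff w x x = 0 := fun x => by simp [firstDiff]
    rw [Finset.sum_insert (by simp [*]), Finset.sum_pair hcd,
      Finset.sum_insert (by simp; tauto), Finset.sum_pair hcd] at hs
    simp only [Finset.sum_insert (show a ∉ ({c, d} : Finset ℕ) by simp [*]),
      Finset.sum_insert (show e ∉ ({c, d} : Finset ℕ) by simp; tauto),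
      Finset.sum_pair hcd, hself, firstDiff_comm w c a, firstDiff_comm w d a,
      firstDiff_comm w e c, hce_p, firstDiff_comm w d e] at hs
    have hs' : ((2 * firstDiff w a d : ℕ) : ZMod p) = (2 * firstDiff w e d : ℕ) := by
      push_cast
      linear_combination hs
    have l1 := (hw.firstDiff_spec ha hd had).1
    have l2 := (hw.firstDiff_spec he hd (Ne.symm hde)).1
    have := natCast_zmod_inj (by nlinarith) (by nlinarith) hs'
    omega
  have heval : (wordPoly w t p a).eval (branch w m t p b c) =
      (wordPoly w t p e).eval (branch w m t p b c) := by
    obtain ⟨x', -, -, h, -⟩ := exists_mem_of_localColor_eq hcol (x := c) (by simp)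
    rwa [Finset.sum_insert (s := {c, d}) (by simp [*]),
      Finset.sum_insert (s := {c, d}) (by simp; tauto), add_left_inj] at h
  obtain ⟨x', hx', hbx, -, hbits⟩ := exists_mem_of_localColor_eq hcole' (x := a) (by simp)
  simp only [Finset.mem_insert, Finset.mem_singleton] at hx'
  rcases hx' with rfl | rfl | rfl
  · refine hw.matchBits_ne hp he ha hb hc hae hbc heval ?_
    rwa [Finset.sum_insert (s := {b, d}) (by simp [*]), Finset.sum_pair hbd,
      Finset.sum_insert (s := {c, d}) (by simp [*]), Finset.sum_pair hcd, add_right_inj,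
      add_left_inj] at hbits
  · exact hnot _ (.inr rfl) hbx
  · have := hw.firstDiff_lt_of_branch_eq hp he ha hd hae hde had hbx
    omega

/-- If none of `a`, `b` and `e` sees a rainbow copy, then `a` and `b` are as in
`IsWordCode.false_of_localColor_eq`, up to symmetry. -/
theorem IsWordCode.false_of_not_rainbow (hw : IsWordCode w m t n) (hp : t * m < p)
    (hm : 2 ≤ m) {a b c d e : ℕ} (l0 : a < n) (l1 : b < n) (l2 : c < n) (l3 : d < n) (l4 : e < n)
    (hnd : [a, b, c, d, e].Nodup)
    (h : ∀ v ∈ ({a, b, e} : Finset ℕ),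
      localColor w m t p v {a, b, d} = localColor w m t p v {b, c, d} ∨
      localColor w m t p v {a, b, d} = localColor w m t p v {c, d, e} ∨
      localColor w m t p v {a, b, d} = localColor w m t p v {a, c, d} ∨
      localColor w m t p v {b, c, d} = localColor w m t p v {c, d, e} ∨
      localColor w m t p v {b, c, d} = localColor w m t p v {a, c, d} ∨
      localColor w m t p v {c, d, e} = localColor w m t p v {a, c, d}) : False := by
  have scde : ({c, d, e} : Finset ℕ) = {e, c, d} := by
    rw [Finset.pair_comm d e, Finset.insert_comm]
  have hnotMem : ∀ {x y z : ℕ}, x ≠ y → x ≠ z → x ∉ ({y, z} : Finset ℕ) :=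
    fun h h' => by simp [h, h']
  have ka := h a (by simp)
  have kb := h b (by simp)
  have ke := h e (by simp)
  have hnd' : [b, a, c, d, e].Nodup := (List.Perm.swap _ _ _).nodup hnd
  have hne := hnd
  simp only [List.nodup_cons, List.mem_cons, List.not_mem_nil, or_false, not_or,
    not_false_eq_true, List.nodup_nil, and_true] at hne
  obtain ⟨⟨h01, h02, h03, h04⟩, ⟨h12, h13, h14⟩, ⟨h23, h24⟩, h34⟩ := hne
  have hmem : ∀ {v E x y z}, v < n → v ∈ E → x < n → y < n → z < n → v ≠ x → v ≠ y → v ≠ z →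
      localColor w m t p v E ≠ localColor w m t p v {x, y, z} := by
    intro v E x y z hv hvE hx hy hz hvx hvy hvz h
    have := hw.mem_of_localColor_eq hp (by simp [*]) hv h hvE
    simp [*] at this
  have hA : branch w m t p a b = branch w m t p a c ∨
      branch w m t p a b = branch w m t p a e ∧
        localColor w m t p a {b, c, d} = localColor w m t p a {e, c, d} := by
    rcases ka with h | h | h | h | h | h
    · exact (hmem l0 (by simp) l1 l2 l3
        h01 h02 h03 h).elim
    · exact (hmem l0 (by simp) l2 l3 l4
        h02 h03 h04 h).elim
    · rw [Finset.insert_comm, Finset.insert_comm a c] at h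
      exact .inl (branch_eq_of_localColor_insert_eq (hnotMem (Ne.symm h01) h13)
        (hnotMem (Ne.symm h02) h23) h)
    · rw [scde] at h
      exact .inr ⟨branch_eq_of_localColor_insert_eq (hnotMem h12 h13)
        (hnotMem (Ne.symm h24) (Ne.symm h34)) h, h⟩
    · exact (hmem l0 (by simp) l1 l2 l3
        h01 h02 h03 h.symm).elim
    · exact (hmem l0 (by simp) l2 l3 l4
        h02 h03 h04 h.symm).elim
  have hB : branch w m t p b a = branch w m t p b c ∨
      branch w m t p b a = branch w m t p b e ∧
        localColor w m t p b {a, c, d} = localColor w m t p b {e, c, d} := by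
    rcases kb with h | h | h | h | h | h
    · rw [Finset.insert_comm b c] at h
      exact .inl (branch_eq_of_localColor_insert_eq (hnotMem h01 h03)
        (hnotMem (Ne.symm h12) h23) h)
    · exact (hmem l1 (by simp) l2 l3 l4
        h12 h13 h14 h).elim
    · exact (hmem l1 (by simp) l0 l2 l3
        (Ne.symm h01) h12 h13 h).elim
    · exact (hmem l1 (by simp) l2 l3 l4
        h12 h13 h14 h).elim
    · exact (hmem l1 (by simp) l0 l2 l3
        (Ne.symm h01) h12 h13 h).elim
    · rw [scde] at h
      exact .inr ⟨branch_eq_of_localColor_insert_eq (hnotMem h02 h03)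
        (hnotMem (Ne.symm h24) (Ne.symm h34)) h.symm, h.symm⟩
  have hE : localColor w m t p e {a, b, d} = localColor w m t p e {c, b, d} ∨
      localColor w m t p e {b, a, d} = localColor w m t p e {c, a, d} ∨
      localColor w m t p e {b, c, d} = localColor w m t p e {a, c, d} := by
    rw [Finset.insert_comm c b, Finset.insert_comm b a, Finset.insert_comm c a]
    rcases ke with h | h | h | h | h | h
    · exact .inl h
    · exact (hmem l4 (by simp) l0 l1 l3
        (Ne.symm h04) (Ne.symm h14) (Ne.symm h34) h.symm).elim
    · exact .inr (.inl h)
    · exact (hmem l4 (by simp) l1 l2 l3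
        (Ne.symm h14) (Ne.symm h24) (Ne.symm h34) h.symm).elim
    · exact .inr (.inr h)
    · exact (hmem l4 (by simp) l0 l2 l3
        (Ne.symm h04) (Ne.symm h24) (Ne.symm h34) h).elim
  have hexcl : ∀ x < n, x ≠ a → x ≠ b → branch w m t p a b = branch w m t p a x →
      branch w m t p b a ≠ branch w m t p b x := by
    intro x hx hxa hxb h h'
    have u1 := hw.firstDiff_lt_of_branch_eq hp l0 l1 hx (Ne.symm h01) hxa hxb.symm h
    have u2 := hw.firstDiff_lt_of_branch_eq hp l1 l0 hx h01 hxb hxa.symm h'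
    rw [firstDiff_comm w b a] at u2
    omega
  rcases hA with hA | ⟨hA, hA'⟩ <;> rcases hB with hB | ⟨hB, hB'⟩
  · exact hexcl c l2 (Ne.symm h02) (Ne.symm h12) hA hB
  · exact hw.false_of_localColor_eq hp hm l0 l1 l2 l3 l4 hnd hA hB' hE
  · exact hw.false_of_localColor_eq hp hm l1 l0 l2 l3 l4 hnd' hB hA'
      (by rcases hE with h | h | h <;> simp [h])
  · exact hexcl e l4 (Ne.symm h04) (Ne.symm h14) hA hB

/-- Among the vertices `a`, `b` and `e` of a copy of `TCe` one sees a rainbow copy. -/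
theorem IsWordCode.exists_injOn_localColor (hw : IsWordCode w m t n) (hp : t * m < p)
    (hm : 2 ≤ m) {φ : ℕ → ℕ} (hφ : IsCopy n TCe φ) :
    ∃ x ∈ TCe.verts, ∀ e₁ ∈ TCe.edges, ∀ e₂ ∈ TCe.edges,
      localColor w m t p (φ x) (e₁.image φ) = localColor w m t p (φ x) (e₂.image φ) →
        e₁ = e₂ := by
  by_contra! hcon
  obtain ⟨hinj, hlt⟩ := hφ
  have key : ∀ x ∈ TCe.verts,
      localColor w m t p (φ x) {φ 0, φ 1, φ 3} = localColor w m t p (φ x) {φ 1, φ 2, φ 3} ∨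
      localColor w m t p (φ x) {φ 0, φ 1, φ 3} = localColor w m t p (φ x) {φ 2, φ 3, φ 4} ∨
      localColor w m t p (φ x) {φ 0, φ 1, φ 3} = localColor w m t p (φ x) {φ 0, φ 2, φ 3} ∨
      localColor w m t p (φ x) {φ 1, φ 2, φ 3} = localColor w m t p (φ x) {φ 2, φ 3, φ 4} ∨
      localColor w m t p (φ x) {φ 1, φ 2, φ 3} = localColor w m t p (φ x) {φ 0, φ 2, φ 3} ∨
      localColor w m t p (φ x) {φ 2, φ 3, φ 4} = localColor w m t p (φ x) {φ 0, φ 2, φ 3} := by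
    intro x hx
    obtain ⟨e₁, he₁, e₂, he₂, h, hne⟩ := hcon x hx
    simp only [TCe, Finset.mem_insert, Finset.mem_singleton] at he₁ he₂
    rcases he₁ with rfl | rfl | rfl | rfl <;> rcases he₂ with rfl | rfl | rfl | rfl <;>
      simp only [Finset.image_insert, Finset.image_singleton] at h <;>
      first | exact absurd rfl hne | simp only [h, true_or, or_true]
  have hlt' : ∀ i ∈ TCe.verts, φ i < n := fun i hi => Finset.mem_range.1 (hlt i hi)
  have hnd : ([0, 1, 2, 3, 4].map φ).Nodup := by
    refine List.Nodup.map_on (fun i hi j hj => hinj ?_ ?_) (by decide)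
    · simpa [TCe] using hi
    · simpa [TCe] using hj
  refine hw.false_of_not_rainbow hp hm (hlt' 0 ?_) (hlt' 1 ?_) (hlt' 2 ?_) (hlt' 3 ?_) (hlt' 4 ?_)
    hnd fun v hv => ?_
  iterate 5 simp [TCe]
  simp only [Finset.mem_insert, Finset.mem_singleton] at hv
  rcases hv with rfl | rfl | rfl <;> exact key _ (by simp [TCe])

/-- A colouring with values in an arbitrary type can be turned into one with `Fintype.card Γ`
colours, provided that the colours of the relevant edges lie in the range of a function on `Γ`. -/
theorem localC_le_card {Γ X : Type*} [Fintype Γ] [Nonempty Γ] {n r : ℕ} {H : HGraph}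
    (hH : H.IsUniform r) (g : Γ → X) (col : ℕ → Finset ℕ → X)
    (hg : ∀ v E, E.card = r → col v E ∈ Set.range g)
    (hcol : ∀ φ : ℕ → ℕ, IsCopy n H φ → ∃ x ∈ H.verts, ∀ e₁ ∈ H.edges, ∀ e₂ ∈ H.edges,
      col (φ x) (e₁.image φ) = col (φ x) (e₂.image φ) → e₁ = e₂) :
    localC n H ≤ Fintype.card Γ := by
  refine Nat.sInf_le ⟨fun v E => Fintype.equivFin Γ (Function.invFun g (col v E)), ?_⟩
  intro φ hφ
  obtain ⟨x, hx, h⟩ := hcol φ hφ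
  refine ⟨x, hx, fun e₁ h₁ e₂ h₂ heq => h e₁ h₁ e₂ h₂ ?_⟩
  have hcard : ∀ e ∈ H.edges, (e.image φ).card = r := fun e he => by
    rw [Finset.card_image_of_injOn (hφ.1.mono (Finset.coe_subset.2 (hH e he).1)), (hH e he).2]
  have := congrArg g ((Fintype.equivFin Γ).injective heq)
  rwa [Function.invFun_eq (hg _ _ (hcard e₁ h₁)), Function.invFun_eq (hg _ _ (hcard e₂ h₂))]
    at this

theorem IsWordCode.localC_TCe_le (hw : IsWordCode w m t n) (hp : t * m < p) (hm : 2 ≤ m) :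
    localC n TCe ≤ p ^ 7 * 8 ^ t := by
  have hunif : TCe.IsUniform 3 := by
    intro e he
    simp only [TCe, Finset.mem_insert, Finset.mem_singleton] at he
    rcases he with rfl | rfl | rfl | rfl <;> decide
  refine (localC_le_card hunif
    (fun γ : ZMod p × (Fin 3 → ZMod p × ZMod p × (Fin t → ZMod 2)) =>
      (γ.1, Multiset.ofList (List.ofFn γ.2)))
    (fun v => localColor w m t p v) ?_
    fun φ hφ => hw.exists_injOn_localColor hp hm hφ).trans ?_
  · intro v E hE
    obtain ⟨x, y, z, h⟩ := Multiset.card_eq_three.1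
      (show (localColor w m t p v E).2.card = 3 by simpa [localColor] using hE)
    exact ⟨((localColor w m t p v E).1, ![x, y, z]), Prod.ext rfl (by simp [h]; rfl)⟩
  · simp only [Fintype.card_prod, Fintype.card_fun, ZMod.card, Fintype.card_fin]
    refine le_of_eq ?_
    rw [show (8 : ℕ) = 2 ^ 3 by norm_num, ← pow_mul]
    ring

end

theorem localC_TCe_le_of_le_pow {n m t : ℕ} (ht : 0 < t) (hm : 2 ≤ m) (hn : n ≤ m ^ t) :
    localC n TCe ≤ (2 * t * m) ^ 7 * 8 ^ t := by
  obtain ⟨p, hp, hlt, hle⟩ := Nat.exists_prime_lt_and_le_two_mul (t * m) (by positivity)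
  have := Fact.mk hp
  refine ((isWordCode_digits (by omega) hn).localC_TCe_le hlt hm).trans ?_
  rw [mul_assoc]
  gcongr

theorem stmt_18 :
    ∀ ε : ℝ, 0 < ε → ∃ n₀ : ℕ, ∀ n : ℕ, n₀ ≤ n →
      (localC n TCe : ℝ) ≤ (n : ℝ) ^ ε := by
  intro ε hε
  obtain ⟨t, ht⟩ := exists_nat_gt (8 / ε)
  have ht0 : (0 : ℝ) < t := (by positivity : 0 < 8 / ε).trans ht
  have ht1 : 0 < t := by exact_mod_cast ht0
  set K : ℝ := (4 * t) ^ 7 * 8 ^ t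
  have htend : Filter.Tendsto (fun n : ℕ => (n : ℝ) ^ (1 / t : ℝ)) Filter.atTop Filter.atTop :=
    (tendsto_rpow_atTop (by positivity)).comp tendsto_natCast_atTop_atTop
  obtain ⟨n₀, hn₀⟩ := Filter.eventually_atTop.1
    ((htend.eventually_ge_atTop K).and (htend.eventually_gt_atTop 1))
  refine ⟨max n₀ 1, fun n hn => ?_⟩
  obtain ⟨hK, h1⟩ := hn₀ n (le_of_max_le_left hn)
  have hn1 : (1 : ℝ) ≤ n := by exact_mod_cast le_of_max_le_right hn
  set y : ℝ := (n : ℝ) ^ (1 / t : ℝ)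
  have hyt : y ^ t = n := by
    rw [← Real.rpow_natCast, ← Real.rpow_mul (by positivity), one_div_mul_cancel ht0.ne',
      Real.rpow_one]
  have hm1 : 1 < ⌈y⌉₊ := Nat.lt_ceil.2 (by simpa using h1)
  have hm2 : (⌈y⌉₊ : ℝ) ≤ 2 * y := by linarith [Nat.ceil_lt_add_one (zero_le_one.trans h1.le)]
  have hle : localC n TCe ≤ (2 * t * ⌈y⌉₊) ^ 7 * 8 ^ t := by
    refine localC_TCe_le_of_le_pow ht1 hm1 ?_
    have : (n : ℝ) ≤ (⌈y⌉₊ : ℝ) ^ t := by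
      rw [← hyt]
      gcongr
      exact Nat.le_ceil y
    exact_mod_cast this
  calc (localC n TCe : ℝ) ≤ (2 * t * ⌈y⌉₊) ^ 7 * 8 ^ t := by exact_mod_cast hle
    _ ≤ (2 * t * (2 * y)) ^ 7 * 8 ^ t := by gcongr
    _ = K * y ^ 7 := by simp only [K]; ring
    _ ≤ y * y ^ 7 := by gcongr
    _ = (n : ℝ) ^ (8 / t : ℝ) := by
      rw [← pow_succ', ← Real.rpow_natCast, ← Real.rpow_mul (by positivity)]
      congr 1
      push_cast
      ring
    _ ≤ (n : ℝ) ^ ε := by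
      refine Real.rpow_le_rpow_of_exponent_le hn1 ?_
      rw [div_le_iff₀ ht0]
      rw [div_lt_iff₀ hε] at ht
      linarith
end
end
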